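/- arXiv:1702.03424 — 4 statements merged into one kernel-verified Lean document; each statement's English description precedes it below -/
import Mathlib

section
/- Let A, B, k be fixed positive integers with min{A, B, k} > 1 and gcd(A, B) = 1. Then the equation A^m + B^n = k has at most two solutions (m, n) in positive integers. -/
theorem pow_lt_pow_sub_of_add_pow_eq {A B m n m' n' : ℕ} (hA : 1 < A) (hB : 1 < B)
    (hAB : Nat.Coprime A B) (h : A ^ m + B ^ n = A ^ m' + B ^ n') (hm : m < m') :
    B ^ n' < A ^ (m' - m) := by
  have hAm : A ^ m < A ^ m' := Nat.pow_lt_pow_right hA hm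
  have hn : n' < n := (Nat.pow_lt_pow_iff_right hB).mp (by omega)
  have hdvd : B ^ n' ∣ A ^ m' - A ^ m := by
    have hsub : A ^ m' - A ^ m = B ^ n - B ^ n' := by omega
    rw [hsub]
    exact Nat.dvd_sub (pow_dvd_pow B hn.le) dvd_rfl
  have hfactor : A ^ m' - A ^ m = A ^ m * (A ^ (m' - m) - 1) := by
    rw [Nat.mul_sub, ← pow_add, Nat.add_sub_cancel' hm.le, mul_one]
  rw [hfactor] at hdvd
  have hone : 1 < A ^ (m' - m) := Nat.one_lt_pow (by omega) hA
  have hle := Nat.le_of_dvd (by omega) ((hAB.symm.pow n' m).dvd_of_dvd_mul_left hdvd)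
  omega

theorem not_three_solutions_add_pow {A B k m₁ n₁ m₂ n₂ m₃ n₃ : ℕ} (hA : 1 < A) (hB : 1 < B)
    (hAB : Nat.Coprime A B) (h₁ : A ^ m₁ + B ^ n₁ = k) (h₂ : A ^ m₂ + B ^ n₂ = k)
    (h₃ : A ^ m₃ + B ^ n₃ = k) (h₁₂ : m₁ < m₂) (h₂₃ : m₂ < m₃) : False := by
  have hlt : A ^ m₂ < A ^ m₃ := Nat.pow_lt_pow_right hA h₂₃
  have hn : n₃ < n₂ := (Nat.pow_lt_pow_iff_right hB).mp (by omega)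
  have hBA : B ^ n₂ < A ^ (m₂ - m₁) :=
    pow_lt_pow_sub_of_add_pow_eq hA hB hAB (h₁.trans h₂.symm) h₁₂
  have hAB' : A ^ m₂ < B ^ (n₂ - n₃) :=
    pow_lt_pow_sub_of_add_pow_eq (m := n₃) (n := m₃) hB hA hAB.symm (by omega) hn
  have hA_le : A ^ (m₂ - m₁) ≤ A ^ m₂ := Nat.pow_le_pow_right (by omega) (Nat.sub_le _ _)
  have hB_le : B ^ (n₂ - n₃) ≤ B ^ n₂ := Nat.pow_le_pow_right (by omega) (Nat.sub_le _ _)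
  omega

theorem at_most_two_solutions_sum (A B k : ℕ)
    (hA : 1 < A) (hB : 1 < B) (hk : 1 < k)
    (hAB : Nat.Coprime A B) :
    {p : ℕ × ℕ | 0 < p.1 ∧ 0 < p.2 ∧ A ^ p.1 + B ^ p.2 = k}.encard ≤ 2 := by
  by_contra! hcard
  obtain ⟨t, ht, htcard⟩ := Set.exists_subset_encard_eq (k := 3) (Order.add_one_le_of_lt hcard)
  obtain ⟨p, q, r, hpq, hpr, hqr, rfl⟩ := Set.encard_eq_three.mp htcard
  obtain ⟨-, -, hp⟩ := ht (show p ∈ _ by simp)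
  obtain ⟨-, -, hq⟩ := ht (show q ∈ _ by simp)
  obtain ⟨-, -, hr⟩ := ht (show r ∈ _ by simp)
  have fst_ne {x y : ℕ × ℕ} (hx : A ^ x.1 + B ^ x.2 = k) (hy : A ^ y.1 + B ^ y.2 = k)
      (hxy : x ≠ y) : x.1 ≠ y.1 := by
    intro hfst
    rw [hfst] at hx
    exact hxy (Prod.ext hfst (Nat.pow_right_injective hB (by simp only; omega)))
  have key {x y z : ℕ × ℕ} (hx : A ^ x.1 + B ^ x.2 = k) (hy : A ^ y.1 + B ^ y.2 = k)
      (hz : A ^ z.1 + B ^ z.2 = k) : ¬ (x.1 < y.1 ∧ y.1 < z.1) :=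
    fun h => not_three_solutions_add_pow hA hB hAB hx hy hz h.1 h.2
  have := fst_ne hp hq hpq
  have := fst_ne hp hr hpr
  have := fst_ne hq hr hqr
  have := key hp hq hr
  have := key hp hr hq
  have := key hq hp hr
  have := key hq hr hp
  have := key hr hp hq
  have := key hr hq hp
  omega
end

section
/- Let A, B, C be pairwise coprime positive integers with min{A, B, C} > 1 and C = max{A, B, C}, and let λ ∈ {1, −1}. Suppose (X₁, Y₁, Z₁) and (X₂, Y₂, Z₂) are solutions in positive integers of A^X + λ·B^Y = C^Z with Z₁ minimal among all solutions and Z₁ < Z₂. Let n₁ be the least positive integer n such that A^n ≡ δ (mod C^(Z₁)) for some δ ∈ {1, −1}, let δ₁ ∈ {1, −1} satisfy A^(n₁) ≡ δ₁ (mod C^(Z₁)), and let f be the positive integer with A^(n₁) = C^(Z₁)·f + δ₁. Then gcd(C, f) ≤ Y₂. -/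
/-- If `n` is the least positive exponent with `a ^ n ≡ ±1 [ZMOD m]`, it divides every such
exponent. -/
theorem dvd_of_pow_modEq_unit {a m : ℤ} {n : ℕ} {δ : ℤ} (hn : 0 < n)
    (hδ : δ = 1 ∨ δ = -1) (hanδ : a ^ n ≡ δ [ZMOD m])
    (hleast : ∀ k : ℕ, 0 < k → (∃ ε : ℤ, (ε = 1 ∨ ε = -1) ∧ a ^ k ≡ ε [ZMOD m]) → n ≤ k)
    {k : ℕ} {ε : ℤ} (hε : ε = 1 ∨ ε = -1) (hk : a ^ k ≡ ε [ZMOD m]) : n ∣ k := by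
  by_contra hnk
  have hr : 0 < k % n := Nat.pos_of_ne_zero fun h => hnk (Nat.dvd_of_mod_eq_zero h)
  refine absurd (hleast (k % n) hr ⟨δ ^ (k / n) * ε, ?_, ?_⟩) (Nat.not_le.2 (Nat.mod_lt _ hn))
  · have h1 : δ ^ (k / n) = 1 ∨ δ ^ (k / n) = -1 := by
      rcases hδ with rfl | rfl
      · simp
      · exact neg_one_pow_eq_or ℤ _
    rcases h1 with h1 | h1 <;> rcases hε with rfl | rfl <;> simp [h1]
  · have h2 : δ ^ (k / n) * δ ^ (k / n) = 1 := by
      rw [← mul_pow]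
      rcases hδ with rfl | rfl <;> simp
    have h3 : δ ^ (k / n) * a ^ (k % n) ≡ ε [ZMOD m] := by
      refine Int.ModEq.trans ?_ hk
      nth_rewrite 3 [← Nat.div_add_mod k n]
      rw [pow_add, pow_mul]
      exact ((hanδ.pow _).symm.mul_right _)
    calc a ^ (k % n) = δ ^ (k / n) * (δ ^ (k / n) * a ^ (k % n)) := by
          rw [← mul_assoc, h2, one_mul]
      _ ≡ δ ^ (k / n) * ε [ZMOD m] := h3.mul_left _

/-- Lifting a congruence `a ^ p ≡ ±a ^ q` from `m` to a modulus at which `a ^ n` is still a sign,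
where `n` is the least positive exponent at which `a ^ n` is a sign modulo `m`. -/
theorem exists_unit_pow_modEq_mul_pow {a m M : ℤ} {n : ℕ} {δ : ℤ} (ham : IsCoprime a m)
    (hmM : m ∣ M) (hn : 0 < n) (hδ : δ = 1 ∨ δ = -1) (hanδ : a ^ n ≡ δ [ZMOD M])
    (hleast : ∀ k : ℕ, 0 < k → (∃ ε : ℤ, (ε = 1 ∨ ε = -1) ∧ a ^ k ≡ ε [ZMOD m]) → n ≤ k)
    {p q : ℕ} {ε : ℤ} (hε : ε = 1 ∨ ε = -1) (hpq : a ^ p ≡ ε * a ^ q [ZMOD m]) :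
    ∃ ε' : ℤ, (ε' = 1 ∨ ε' = -1) ∧ a ^ p ≡ ε' * a ^ q [ZMOD M] := by
  have hεε : ε * ε = 1 := by rcases hε with rfl | rfl <;> simp
  have key : ∀ r s : ℕ, r ≤ s → a ^ s ≡ ε * a ^ r [ZMOD m] →
      ∃ ε' : ℤ, (ε' = 1 ∨ ε' = -1) ∧ a ^ s ≡ ε' * a ^ r [ZMOD M] := by
    intro r s hrs h
    obtain ⟨k, rfl⟩ := Nat.exists_eq_add_of_le hrs
    have hk : a ^ k ≡ ε [ZMOD m] := by
      rw [Int.modEq_iff_dvd] at h ⊢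
      have h' : m ∣ a ^ r * (ε - a ^ k) := by
        convert h using 1
        ring
      exact (ham.symm.pow_right).dvd_of_dvd_mul_left h'
    obtain ⟨t, rfl⟩ := dvd_of_pow_modEq_unit hn hδ (hanδ.of_dvd hmM) hleast hε hk
    refine ⟨δ ^ t, ?_, ?_⟩
    · rcases hδ with rfl | rfl
      · simp
      · exact neg_one_pow_eq_or ℤ _
    · rw [pow_add, pow_mul, mul_comm]
      exact (hanδ.pow t).mul_right _
  rcases le_total q p with h | h
  · exact key q p h hpq
  · have hqp : a ^ q ≡ ε * a ^ p [ZMOD m] := by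
      have := (hpq.mul_left ε).symm
      rwa [← mul_assoc, hεε, one_mul] at this
    obtain ⟨ε', hε', h'⟩ := key p q h hqp
    refine ⟨ε', hε', ?_⟩
    have := (h'.mul_left ε').symm
    rwa [← mul_assoc, show ε' * ε' = 1 by rcases hε' with rfl | rfl <;> simp, one_mul] at this


/-- `(X, Y, Z)` is a positive-integer solution of `A^X + λ·B^Y = C^Z`. -/
def IsSol (A B C : ℕ) (l : ℤ) (X Y Z : ℕ) : Prop :=
  0 < X ∧ 0 < Y ∧ 0 < Z ∧ (A : ℤ) ^ X + l * (B : ℤ) ^ Y = (C : ℤ) ^ Z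

theorem gcd_C_f_le_Y2 (A B C : ℕ) (l : ℤ)
    (hA : 1 < A) (hB : 1 < B) (hC : 1 < C)
    (hAB : Nat.Coprime A B) (hAC : Nat.Coprime A C) (hBC : Nat.Coprime B C)
    (hCmax : C = max A (max B C))
    (hl : l = 1 ∨ l = -1)
    (X₁ Y₁ Z₁ X₂ Y₂ Z₂ : ℕ)
    (hsol₁ : IsSol A B C l X₁ Y₁ Z₁) (hsol₂ : IsSol A B C l X₂ Y₂ Z₂)
    (hZ₁min : ∀ X Y Z, IsSol A B C l X Y Z → Z₁ ≤ Z)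
    (hZ₁Z₂ : Z₁ < Z₂)
    (n₁ : ℕ) (δ₁ : ℤ)
    (hn₁pos : 0 < n₁)
    (hδ₁ : δ₁ = 1 ∨ δ₁ = -1)
    (hn₁ : (A : ℤ) ^ n₁ ≡ δ₁ [ZMOD (C : ℤ) ^ Z₁])
    (hn₁least : ∀ n : ℕ, 0 < n →
      (∃ δ : ℤ, (δ = 1 ∨ δ = -1) ∧ (A : ℤ) ^ n ≡ δ [ZMOD (C : ℤ) ^ Z₁]) → n₁ ≤ n)
    (f : ℕ) (hfpos : 0 < f)
    (hf : (A : ℤ) ^ n₁ = (C : ℤ) ^ Z₁ * (f : ℤ) + δ₁) :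
    Nat.gcd C f ≤ Y₂ := by
  obtain ⟨-, -, hZ₁pos, e₁⟩ := hsol₁
  obtain ⟨-, hY₂pos, -, e₂⟩ := hsol₂
  have hAC' : IsCoprime (A : ℤ) C := Nat.isCoprime_iff_coprime.2 hAC
  have hBC' : IsCoprime (B : ℤ) C := Nat.isCoprime_iff_coprime.2 hBC
  have hC2 : 2 < C := by
    have hAleC : A ≤ C := hCmax ▸ le_max_left _ _
    have hne : A ≠ C := by
      rintro rfl
      exact absurd ((Nat.coprime_self _).1 hAC) hA.ne'
    omega
  obtain ⟨s, hs, rfl⟩ : ∃ s : ℤ, (s = 1 ∨ s = -1) ∧ l = -s :=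
    ⟨-l, by rcases hl with rfl | rfl <;> simp, by simp⟩
  have hss : s * s = 1 := by rcases hs with rfl | rfl <;> simp
  have hsign : ∀ k : ℕ, s ^ k = 1 ∨ s ^ k = -1 := by
    intro k
    rcases hs with rfl | rfl
    · simp
    · exact neg_one_pow_eq_or ℤ k
  set m : ℤ := (C : ℤ) ^ Z₁ with hm
  set d : ℕ := Nat.gcd C f with hd
  have hdC : (d : ℤ) ∣ C := Int.natCast_dvd_natCast.2 (Nat.gcd_dvd_left _ _)
  have hdf : (d : ℤ) ∣ f := Int.natCast_dvd_natCast.2 (Nat.gcd_dvd_right _ _)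
  have hCm : (C : ℤ) ∣ m := dvd_pow_self _ hZ₁pos.ne'
  have hMsq : m * d ∣ m ^ 2 := by
    rw [sq]
    exact mul_dvd_mul_left _ (hdC.trans hCm)
  have hMZ₂ : m * d ∣ (C : ℤ) ^ Z₂ :=
    (mul_dvd_mul_left _ hdC).trans (by rw [hm, ← pow_succ]; exact pow_dvd_pow _ hZ₁Z₂)
  have hmM : m ∣ m * d := dvd_mul_right _ _
  have hAn : (A : ℤ) ^ n₁ ≡ δ₁ [ZMOD m * d] := by
    refine (Int.modEq_iff_dvd.2 ?_).symm
    rw [hf, add_sub_cancel_right]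
    exact mul_dvd_mul_left _ hdf
  have hAm : IsCoprime (A : ℤ) m := hAC'.pow_right
  have hBm : IsCoprime (B : ℤ) m := hBC'.pow_right
  have hmpos : 2 < m := by
    have h1 : C ≤ C ^ Z₁ := Nat.le_self_pow hZ₁pos.ne' C
    have h2 : ((C ^ Z₁ : ℕ) : ℤ) = m := by push_cast; rfl
    omega
  obtain ⟨k, hk⟩ := Polynomial.powAddExpansion (s * (B : ℤ) ^ Y₁) m Y₂
  have hfirst : (A : ℤ) ^ (X₁ * Y₂) ≡ s ^ Y₂ * (B : ℤ) ^ (Y₁ * Y₂) +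
      Y₂ * (s * (B : ℤ) ^ Y₁) ^ (Y₂ - 1) * m [ZMOD m * d] := by
    have hA₁ : (A : ℤ) ^ X₁ = s * (B : ℤ) ^ Y₁ + m := by linarith
    rw [pow_mul, hA₁, hk, mul_pow, ← pow_mul]
    refine (Int.modEq_iff_dvd.2 ?_).symm
    rw [add_sub_cancel_left]
    exact hMsq.mul_left _
  have hsecond : (A : ℤ) ^ (X₂ * Y₁) ≡ s ^ Y₁ * (B : ℤ) ^ (Y₁ * Y₂) [ZMOD m * d] := by
    have hA₂ : (A : ℤ) ^ X₂ ≡ s * (B : ℤ) ^ Y₂ [ZMOD m * d] := by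
      refine (Int.modEq_iff_dvd.2 ?_).symm
      convert hMZ₂ using 1
      linarith
    have := hA₂.pow Y₁
    rwa [mul_pow, ← pow_mul, ← pow_mul, mul_comm Y₂ Y₁] at this
  have hfirst_m : (A : ℤ) ^ (X₁ * Y₂) ≡ s ^ Y₂ * (B : ℤ) ^ (Y₁ * Y₂) [ZMOD m] := by
    refine (hfirst.of_dvd hmM).trans (Int.modEq_iff_dvd.2 ?_).symm
    rw [add_sub_cancel_left]
    exact dvd_mul_left _ _
  have hpow : ∀ k : ℕ, s ^ k * s ^ k = 1 := fun k => by rw [← mul_pow, hss, one_pow]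
  have hpq : (A : ℤ) ^ (X₁ * Y₂) ≡ s ^ (Y₁ + Y₂) * (A : ℤ) ^ (X₂ * Y₁) [ZMOD m] := by
    refine hfirst_m.trans ?_
    rw [add_comm Y₁, pow_add]
    have := (hsecond.of_dvd hmM).symm.mul_left (s ^ Y₂ * s ^ Y₁)
    rwa [← mul_assoc, mul_assoc (s ^ Y₂), hpow, mul_one] at this
  obtain ⟨ε, hε, hpq'⟩ := exists_unit_pow_modEq_mul_pow hAm hmM hn₁pos hδ₁ hAn hn₁least
    (hsign _) hpq
  have hthird : (A : ℤ) ^ (X₁ * Y₂) ≡ ε * s ^ Y₁ * (B : ℤ) ^ (Y₁ * Y₂) [ZMOD m * d] := by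
    rw [mul_assoc]
    exact hpq'.trans (hsecond.mul_left ε)
  have hεs : ε * s ^ Y₁ = s ^ Y₂ := by
    have h1 : m ∣ (B : ℤ) ^ (Y₁ * Y₂) * (ε * s ^ Y₁ - s ^ Y₂) := by
      have := Int.modEq_iff_dvd.1 (hfirst_m.symm.trans (hthird.of_dvd hmM))
      convert this using 1
      ring
    have h2 : m ∣ ε * s ^ Y₁ - s ^ Y₂ := hBm.symm.pow_right.dvd_of_dvd_mul_left h1
    have h3 : |ε * s ^ Y₁ - s ^ Y₂| < m := by
      refine lt_of_le_of_lt ?_ hmpos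
      rcases hε with rfl | rfl <;> rcases hsign Y₁ with h | h <;>
        rcases hsign Y₂ with h' | h' <;> rw [h, h'] <;> norm_num
    exact sub_eq_zero.1 (Int.eq_zero_of_abs_lt_dvd h2 h3)
  rw [hεs] at hthird
  have hdvd : m * d ∣ m * ((s * (B : ℤ) ^ Y₁) ^ (Y₂ - 1) * Y₂) := by
    have := Int.modEq_iff_dvd.1 (hthird.symm.trans hfirst)
    rw [add_sub_cancel_left] at this
    convert this using 1
    ring
  have hdY : (d : ℤ) ∣ (s * (B : ℤ) ^ Y₁) ^ (Y₂ - 1) * Y₂ :=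
    (mul_dvd_mul_iff_left (by omega)).1 hdvd
  have hcop : IsCoprime (d : ℤ) ((s * (B : ℤ) ^ Y₁) ^ (Y₂ - 1)) := by
    refine IsCoprime.pow_right (IsCoprime.mul_right ⟨0, s, by simp [hss]⟩ ?_)
    exact (hBC'.symm.of_isCoprime_of_dvd_left hdC).pow_right
  exact Nat.le_of_dvd hY₂pos (Int.natCast_dvd_natCast.1 (hcop.dvd_of_dvd_mul_left hdY))
end

section
/- The equation 3^x + 5^y = 2^z has exactly three solutions in positive integers (x, y, z), namely (1, 1, 3), (3, 1, 5) and (1, 3, 7). -/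
set_option synthInstance.maxSize 1000 in
theorem no_residues_of_three_pow_add_five_pow :
    ∀ x < 64, ∀ y < 64, (3 ^ x + 5 ^ y) % 256 = 0 → ∀ i < 4, ∀ j < 4, ∀ z < 16,
      (3 ^ (x + 64 * i) + 5 ^ (y + 64 * j)) % 4369 ≠ 2 ^ z % 4369 := by
  decide +kernel

theorem pow_mod_exponent_modEq {a k n : ℕ} (h : a ^ k ≡ 1 [MOD n]) (m : ℕ) :
    a ^ (m % k) ≡ a ^ m [MOD n] := by
  conv_rhs => rw [← Nat.mod_add_div m k, pow_add, pow_mul]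
  simpa using ((h.pow (m / k)).mul_left (a ^ (m % k))).symm

theorem exponent_lt_eight_of_three_pow_add_five_pow {x y z : ℕ}
    (h : 3 ^ x + 5 ^ y = 2 ^ z) : z < 8 := by
  by_contra! hz
  have reduce (k n : ℕ) (h3 : 3 ^ k ≡ 1 [MOD n]) (h5 : 5 ^ k ≡ 1 [MOD n]) :
      3 ^ (x % k) + 5 ^ (y % k) ≡ 2 ^ z [MOD n] :=
    h ▸ (pow_mod_exponent_modEq h3 x).add (pow_mod_exponent_modEq h5 y)
  have h256 : (3 ^ (x % 64) + 5 ^ (y % 64)) % 256 = 0 :=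
    (reduce 64 256 (by decide +kernel) (by decide +kernel)).trans
      (Nat.modEq_zero_iff_dvd.2 (pow_dvd_pow 2 hz))
  have h4369 : 3 ^ (x % (64 * 4)) + 5 ^ (y % (64 * 4)) ≡ 2 ^ (z % 16) [MOD 4369] :=
    (reduce (64 * 4) 4369 (by decide +kernel) (by decide +kernel)).trans
      (pow_mod_exponent_modEq (by decide +kernel) z).symm
  rw [Nat.mod_mul, Nat.mod_mul] at h4369
  exact no_residues_of_three_pow_add_five_pow _ (Nat.mod_lt _ (by norm_num)) _
    (Nat.mod_lt _ (by norm_num)) h256 _ (Nat.mod_lt _ (by norm_num)) _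
    (Nat.mod_lt _ (by norm_num)) _ (Nat.mod_lt _ (by norm_num)) h4369

theorem sols_3x_5y_2z :
    {p : ℕ × ℕ × ℕ | 0 < p.1 ∧ 0 < p.2.1 ∧ 0 < p.2.2 ∧
      3 ^ p.1 + 5 ^ p.2.1 = 2 ^ p.2.2} =
    {(1, 1, 3), (3, 1, 5), (1, 3, 7)} := by
  ext ⟨x, y, z⟩
  simp only [Set.mem_ofPred_eq, Set.mem_insert_iff, Set.mem_singleton_iff, Prod.mk.injEq]
  constructor
  · rintro ⟨hx, hy, -, h⟩
    have hz := exponent_lt_eight_of_three_pow_add_five_pow h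
    have h3 : 0 < 3 ^ x := by positivity
    have h5 : 0 < 5 ^ y := by positivity
    have hle : 2 ^ z ≤ 2 ^ 7 := Nat.pow_le_pow_right (by norm_num) (by omega)
    have hx5 : x < 5 := (Nat.pow_lt_pow_iff_right (by norm_num : 1 < 3)).1 (by linarith)
    have hy4 : y < 4 := (Nat.pow_lt_pow_iff_right (by norm_num : 1 < 5)).1 (by linarith)
    interval_cases x <;> interval_cases y <;> interval_cases z <;> simp_all
  · rintro (⟨rfl, rfl, rfl⟩ | ⟨rfl, rfl, rfl⟩ | ⟨rfl, rfl, rfl⟩) <;> norm_num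
end

section
/- Let A, B, C be pairwise coprime positive integers with min{A, B, C} > 1 and C = max{A, B, C}, and let λ ∈ {1, −1}. Suppose (X₁, Y₁, Z₁) and (X₂, Y₂, Z₂) are solutions in positive integers of A^X + λ·B^Y = C^Z with Z₁ minimal among all solutions and Z₁ < Z₂. Let n₁ be the least positive integer n with A^n ≡ ±1 (mod C^(Z₁)), let δ₁ ∈ {1, −1} satisfy A^(n₁) ≡ δ₁ (mod C^(Z₁)), and let f = (A^(n₁) − δ₁)/C^(Z₁). Then there exists a positive integer g such that A^|X₁Y₂ − X₂Y₁| − (−λ)^(Y₁ + Y₂) = C^(Z₁)·g, gcd(C, g) = gcd(C, Y₂), and f divides g. -/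
theorem exists_prime_dvd_odd_or_four_dvd {C : ℕ} (hC : 3 ≤ C) :
    ∃ p : ℕ, p.Prime ∧ p ∣ C ∧ (Odd p ∨ p = 2 ∧ 4 ∣ C) := by
  rcases Nat.eq_two_pow_or_exists_odd_prime_and_dvd C with ⟨k, rfl⟩ | ⟨p, hp, hpC, hodd⟩
  · have hk : 2 ≤ k := by
      by_contra! h
      interval_cases k <;> omega
    exact ⟨2, Nat.prime_two, dvd_pow_self 2 (by omega), Or.inr ⟨rfl, pow_dvd_pow 2 hk⟩⟩
  · exact ⟨p, hp, hpC, Or.inl hodd⟩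

theorem mul_sub_lt_pow_sub_pow {w z : ℤ} (hz : 1 < z) (hzw : z < w) {n : ℕ} (hn : 2 ≤ n) :
    n * (w - z) < w ^ n - z ^ n := by
  induction n, hn using Nat.le_induction with
  | base => push_cast; nlinarith
  | succ n hn ih =>
    have h1 : 0 < z ^ n := by positivity
    have h2 : 0 ≤ (n : ℤ) * (w - z) := mul_nonneg (by positivity) (by linarith)
    have h3 : w ^ (n + 1) - z ^ (n + 1) = w * (w ^ n - z ^ n) + z ^ n * (w - z) := by ring
    rw [h3]
    push_cast
    nlinarith

theorem mul_lt_pow_of_three_le {x : ℤ} (hx : 1 < x) {n : ℕ} (hn : 3 ≤ n) : n * x < x ^ n := by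
  induction n, hn using Nat.le_induction with
  | base => push_cast; nlinarith [mul_pos (by linarith : 0 < x) (by linarith : 0 < x - 1)]
  | succ n hn ih =>
    have h2 : x ≤ n * x := by
      have : (1 : ℤ) ≤ n := by exact_mod_cast (by omega : 1 ≤ n)
      nlinarith
    rw [pow_succ]
    push_cast
    nlinarith

/-- If `w - z` is a power of `C` and `w`, `z` are coprime to `C`, then `w ^ t - z ^ t` is not a
larger power of `C`. -/
theorem pow_sub_pow_ne_of_sub_eq_pow {w z : ℤ} {C t m n : ℕ} (hC : 3 ≤ C) (hm : 0 < m)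
    (hmn : m < n) (hzC : IsCoprime z C) (hw : 1 < w) (hz : 1 < z ∨ z < -1 ∧ Odd t)
    (hsub : w - z = (C : ℤ) ^ m) : w ^ t - z ^ t ≠ (C : ℤ) ^ n := by
  intro hpow
  obtain ⟨p, hp, hpC, hpar⟩ := exists_prime_dvd_odd_or_four_dvd hC
  have hpC' : (p : ℤ) ∣ C := by exact_mod_cast hpC
  have hCpos : (0 : ℤ) < C := by exact_mod_cast (by omega : 0 < C)
  have hdvd_sub {q : ℤ} (hq : q ∣ C) : q ∣ w - z := hsub ▸ hq.trans (dvd_pow_self _ hm.ne')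
  have hwz : 0 < w - z := hsub ▸ pow_pos hCpos m
  -- a prime factor of `C` dividing a quotient `(w ^ k - z ^ k) / (w - z)` divides `k`
  have hprime {q k : ℕ} (hq : q.Prime) (hqC : q ∣ C)
      (h : (q : ℤ) ∣ ∑ i ∈ Finset.range k, w ^ i * z ^ (k - 1 - i)) : q ∣ k := by
    have hqC' : (q : ℤ) ∣ C := by exact_mod_cast hqC
    have hq' := Nat.prime_iff_prime_int.mp hq
    rw [dvd_geom_sum₂_iff_of_dvd_sub (hdvd_sub hqC')] at h
    rcases hq'.dvd_or_dvd h with h | h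
    · exact_mod_cast h
    · exact absurd (hzC.isUnit_of_dvd' (hq'.dvd_of_dvd_pow h) hqC') hq'.not_isUnit
  have hgeom (k : ℕ) := geom_sum₂_mul w z k
  have hquot : ∑ i ∈ Finset.range t, w ^ i * z ^ (t - 1 - i) = (C : ℤ) ^ (n - m) := by
    apply mul_right_cancel₀ hwz.ne'
    rw [hgeom, hpow, hsub, ← pow_add]
    congr 1
    omega
  have hpt : p ∣ t := hprime hp hpC (by
    rw [hquot]; exact hpC'.trans (dvd_pow_self _ (by omega)))
  set R := ∑ i ∈ Finset.range p, w ^ i * z ^ (p - 1 - i) with hR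
  have hRdvd : R ∣ (C : ℤ) ^ n := by
    obtain ⟨j, rfl⟩ := hpt
    rw [← hpow, pow_mul, pow_mul]
    exact (Dvd.intro _ (hgeom p)).trans (sub_dvd_pow_sub_pow _ _ j)
  have hR0 : R ≠ 0 := by
    rintro h
    rw [h, zero_dvd_iff] at hRdvd
    exact (pow_pos hCpos n).ne' hRdvd
  have hRp : R.natAbs = p ^ R.natAbs.primeFactorsList.length := by
    apply Nat.eq_prime_pow_of_unique_prime_dvd (Int.natAbs_ne_zero.mpr hR0)
    intro d hd hdR
    have hdR' : (d : ℤ) ∣ R := Int.natCast_dvd.mpr hdR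
    have hdC : d ∣ C := hd.dvd_of_dvd_pow (by exact_mod_cast hdR'.trans hRdvd : d ∣ C ^ n)
    exact (Nat.prime_dvd_prime_iff_eq hd hp).mp (hprime hd hdC hdR')
  have hp' := Nat.prime_iff_prime_int.mp hp
  have hzp : ¬ (p : ℤ) ∣ z := fun h ↦ hp'.not_isUnit (hzC.isUnit_of_dvd' h hpC')
  have hsq : ¬ (p : ℤ) ^ 2 ∣ R := by
    intro h
    rcases hpar with hodd | ⟨rfl, h4⟩
    · obtain ⟨b, hb⟩ := hdvd_sub hpC'
      have h2 := odd_sq_dvd_geom_sum₂_sub z b hodd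
      rw [← hb, add_sub_cancel, ← hR, dvd_sub_right h, sq] at h2
      exact hzp (hp'.dvd_of_dvd_pow (Int.dvd_of_mul_dvd_mul_left (by exact_mod_cast hp.ne_zero) h2))
    · have h4' : (4 : ℤ) ∣ w - z := hdvd_sub (by exact_mod_cast h4)
      simp [Finset.sum_range_succ] at hR
      rw [hR] at h
      push_cast at h hzp
      omega
  have hRle : R.natAbs ≤ p := by
    have hlen : R.natAbs.primeFactorsList.length ≤ 1 := by
      by_contra! hlen
      apply hsq
      rw [← Int.natCast_pow, Int.natCast_dvd, hRp]
      exact pow_dvd_pow p hlen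
    calc R.natAbs = _ := hRp
      _ ≤ p ^ 1 := Nat.pow_le_pow_right hp.pos hlen
      _ = p := pow_one p
  have hRle' : R ≤ p := by omega
  have hle : w ^ p - z ^ p ≤ p * (w - z) := by
    rw [← hgeom p]
    exact mul_le_mul_of_nonneg_right hRle' hwz.le
  rcases hz with hz | ⟨hz, hodd⟩
  · exact absurd hle (mul_sub_lt_pow_sub_pow hz (by linarith) hp.two_le).not_ge
  · have hpodd : Odd p := hodd.of_dvd_nat hpt
    have hp3 : 3 ≤ p := by
      have := hp.two_le
      obtain ⟨r, hr⟩ := hpodd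
      omega
    have h1 := mul_lt_pow_of_three_le hw hp3
    have h2 := mul_lt_pow_of_three_le (by linarith : 1 < -z) hp3
    rw [hpodd.neg_pow] at h2
    linarith

theorem dvd_sub_of_dvd_pow_sub_pow {w z : ℤ} {N s t : ℕ} (hst : s.Coprime t)
    (hw : IsCoprime (N : ℤ) w) (hz : IsCoprime (N : ℤ) z) (hs : (N : ℤ) ∣ w ^ s - z ^ s)
    (ht : (N : ℤ) ∣ w ^ t - z ^ t) : (N : ℤ) ∣ w - z := by
  obtain ⟨a, ha⟩ := (ZMod.coe_int_isUnit_iff_isCoprime w N).mpr hw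
  obtain ⟨b, hb⟩ := (ZMod.coe_int_isUnit_iff_isCoprime z N).mpr hz
  have key {k : ℕ} : (N : ℤ) ∣ w ^ k - z ^ k ↔ (a / b) ^ k = 1 := by
    rw [← ZMod.intCast_zmod_eq_zero_iff_dvd, div_pow, div_eq_one, Units.ext_iff]
    push_cast
    rw [ha, hb, sub_eq_zero]
  have h := pow_gcd_eq_one.mpr ⟨key.mp hs, key.mp ht⟩
  rw [hst] at h
  simpa using key.mpr h

theorem IsSol.mul_ne_mul {A B C : ℕ} {l : ℤ} {X₁ Y₁ Z₁ X₂ Y₂ Z₂ : ℕ} (hC : 3 ≤ C) (hA : 1 < A)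
    (hB : 1 < B) (hAC : A.Coprime C) (hBC : B.Coprime C) (hl : l = 1 ∨ l = -1)
    (h₁ : IsSol A B C l X₁ Y₁ Z₁) (h₂ : IsSol A B C l X₂ Y₂ Z₂) (hZ : Z₁ < Z₂) :
    X₁ * Y₂ ≠ X₂ * Y₁ := by
  intro hprop
  obtain ⟨hX₁, hY₁, hZ₁, e₁⟩ := h₁
  obtain ⟨hX₂, hY₂, hZ₂, e₂⟩ := h₂
  obtain ⟨s, t, hst, hs, ht⟩ := Nat.exists_coprime Y₁ Y₂
  set b := Y₁.gcd Y₂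
  have hb : 0 < b := Nat.gcd_pos_of_pos_left _ hY₁
  have hs0 : 0 < s := Nat.pos_of_mul_pos_right (hs ▸ hY₁)
  have hXst : X₁ * t = X₂ * s := by
    apply Nat.eq_of_mul_eq_mul_right hb
    rw [mul_assoc, mul_assoc, ← hs, ← ht, hprop]
  obtain ⟨a, ha⟩ : s ∣ X₁ := hst.dvd_of_dvd_mul_right (Dvd.intro_left _ hXst.symm)
  have ha₂ : X₂ = t * a := by
    apply Nat.eq_of_mul_eq_mul_right hs0
    rw [← hXst, ha]
    ring
  have ha0 : a ≠ 0 := by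
    rintro rfl
    simp at ha
    omega
  have hAC' : IsCoprime (C : ℤ) ((A : ℤ) ^ a) :=
    (Nat.isCoprime_iff_coprime.mpr hAC.symm).pow_right
  have hBC' : IsCoprime (C : ℤ) ((B : ℤ) ^ b) :=
    (Nat.isCoprime_iff_coprime.mpr hBC.symm).pow_right
  have hAa : (1 : ℤ) < (A : ℤ) ^ a := one_lt_pow₀ (by exact_mod_cast hA) ha0
  have hBb : (1 : ℤ) < (B : ℤ) ^ b := one_lt_pow₀ (by exact_mod_cast hB) hb.ne'
  rw [ha, hs, mul_comm s, mul_comm s, pow_mul, pow_mul] at e₁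
  rw [ha₂, ht, mul_comm t, mul_comm t, pow_mul, pow_mul] at e₂
  generalize (A : ℤ) ^ a = w at *
  generalize (B : ℤ) ^ b = y at *
  have hodd : l = 1 → Odd s ∧ Odd t := by
    rintro rfl
    have d₁ : (C : ℤ) ∣ w ^ s - -1 * y ^ s :=
      ⟨(C : ℤ) ^ (Z₁ - 1), by rw [mul_pow_sub_one hZ₁.ne', ← e₁]; ring⟩
    have d₂ : (C : ℤ) ∣ w ^ t - -1 * y ^ t :=
      ⟨(C : ℤ) ^ (Z₂ - 1), by rw [mul_pow_sub_one hZ₂.ne', ← e₂]; ring⟩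
    have d₃ := dvd_sub (d₁.trans (sub_dvd_pow_sub_pow _ _ t)) (d₂.trans (sub_dvd_pow_sub_pow _ _ s))
    have d₄ : (C : ℤ) ∣ ((-1) ^ s - (-1) ^ t) * y ^ (s * t) := by
      refine d₃.trans (dvd_of_eq ?_)
      rw [mul_pow, mul_pow, ← pow_mul, ← pow_mul, ← pow_mul, ← pow_mul, mul_comm t s]
      ring
    have d₅ := hBC'.pow_right.dvd_of_dvd_mul_right d₄
    have hC2 (d : (C : ℤ) ∣ 2) : False := by
      have := Int.le_of_dvd (by norm_num) d
      omega
    rcases Nat.even_or_odd s with hse | hso <;> rcases Nat.even_or_odd t with hte | hto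
    · have := Nat.dvd_gcd hse.two_dvd hte.two_dvd
      rw [hst] at this
      omega
    · rw [hse.neg_one_pow, hto.neg_one_pow] at d₅
      norm_num at d₅
      exact (hC2 d₅).elim
    · rw [hso.neg_one_pow, hte.neg_one_pow] at d₅
      norm_num at d₅
      exact (hC2 d₅).elim
    · exact ⟨hso, hto⟩
  obtain ⟨z, hz, hzC, hz₁, hz₂⟩ : ∃ z : ℤ, (1 < z ∨ z < -1 ∧ Odd t) ∧ IsCoprime (C : ℤ) z ∧
      w ^ s - z ^ s = (C : ℤ) ^ Z₁ ∧ w ^ t - z ^ t = (C : ℤ) ^ Z₂ := by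
    rcases hl with rfl | rfl
    · obtain ⟨hso, hto⟩ := hodd rfl
      refine ⟨-y, Or.inr ⟨by linarith, hto⟩, hBC'.neg_right, ?_, ?_⟩
      · rw [hso.neg_pow]; linarith
      · rw [hto.neg_pow]; linarith
    · exact ⟨y, Or.inl hBb, hBC', by linarith, by linarith⟩
  have hCpos : (0 : ℤ) < C := by exact_mod_cast (by omega : 0 < C)
  have hdvd : ((C ^ Z₁ : ℕ) : ℤ) ∣ w - z := by
    apply dvd_sub_of_dvd_pow_sub_pow hst <;> push_cast
    · exact hAC'.pow_left
    · exact hzC.pow_left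
    · rw [hz₁]
    · rw [hz₂]; exact pow_dvd_pow _ hZ.le
  push_cast at hdvd
  have hdvd' : w - z ∣ (C : ℤ) ^ Z₁ := hz₁ ▸ sub_dvd_pow_sub_pow w z s
  have hwz : 0 ≤ w - z := by
    rcases hz with hz | ⟨hz, -⟩
    · by_contra! h
      have h1 : w ^ s ≤ z ^ s := pow_le_pow_left₀ (by linarith) (by linarith) s
      have h2 : 0 < (C : ℤ) ^ Z₁ := by positivity
      linarith
    · linarith
  have hsub : w - z = (C : ℤ) ^ Z₁ := Int.dvd_antisymm hwz (by positivity) hdvd' hdvd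
  exact pow_sub_pow_ne_of_sub_eq_pow hC hZ₁ hZ hzC.symm hAa hz hsub hz₂

theorem IsSol.exists_pow_sub_eq {A B C : ℕ} {l : ℤ} {X₁ Y₁ Z₁ X₂ Y₂ Z₂ : ℕ}
    (hBC : B.Coprime C) (hl : l = 1 ∨ l = -1) (h₁ : IsSol A B C l X₁ Y₁ Z₁)
    (h₂ : IsSol A B C l X₂ Y₂ Z₂) (hZ : Z₁ < Z₂) :
    ∃ h : ℤ, (A : ℤ) ^ (X₁ * Y₂) - (-l) ^ (Y₁ + Y₂) * (A : ℤ) ^ (X₂ * Y₁) = (C : ℤ) ^ Z₁ * h ∧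
      Int.gcd C h = Nat.gcd C Y₂ := by
  obtain ⟨-, -, hZ₁, e₁⟩ := h₁
  obtain ⟨-, -, -, e₂⟩ := h₂
  have hBC' : IsCoprime (C : ℤ) B := Nat.isCoprime_iff_coprime.mpr hBC.symm
  have hlu : IsUnit (-l) := by rcases hl with rfl | rfl <;> simp
  have hu : (A : ℤ) ^ X₁ = -l * B ^ Y₁ + C ^ Z₁ := by linarith
  have hU : (A : ℤ) ^ X₂ = -l * B ^ Y₂ + C ^ Z₂ := by linarith
  obtain ⟨k, hk⟩ := Polynomial.powAddExpansion (-l * (B : ℤ) ^ Y₁) ((C : ℤ) ^ Z₁) Y₂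
  obtain ⟨j, hj⟩ := sub_dvd_pow_sub_pow ((A : ℤ) ^ X₂) (-l * (B : ℤ) ^ Y₂) Y₁
  rw [hU, add_sub_cancel_left, sub_eq_iff_eq_add] at hj
  set ε := (-l) ^ (Y₁ + Y₂) with hε
  have hv : (-l * (B : ℤ) ^ Y₁) ^ Y₂ = ε * (-l * (B : ℤ) ^ Y₂) ^ Y₁ := by
    have hsq : (-l) ^ Y₁ * (-l) ^ Y₁ = 1 := by
      rw [← mul_pow]
      rcases hl with rfl | rfl <;> simp
    rw [mul_pow, mul_pow, ← pow_mul, ← pow_mul, mul_comm Y₂ Y₁, hε, pow_add]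
    linear_combination (-(-l) ^ Y₂ * (B : ℤ) ^ (Y₁ * Y₂)) * hsq
  have hc₁ : (C : ℤ) ^ Z₁ = C * C ^ (Z₁ - 1) := (mul_pow_sub_one hZ₁.ne' _).symm
  have hc₂ : (C : ℤ) ^ Z₂ = C ^ Z₁ * (C * C ^ (Z₂ - Z₁ - 1)) := by
    rw [mul_pow_sub_one (by omega), ← pow_add]
    congr 1
    omega
  refine ⟨Y₂ * (-l * (B : ℤ) ^ Y₁) ^ (Y₂ - 1) +
    C * (k * C ^ (Z₁ - 1) - ε * C ^ (Z₂ - Z₁ - 1) * j), ?_, ?_⟩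
  · rw [pow_mul, pow_mul, hU, hj, hu, hk, hv, hc₂]
    linear_combination (k * (C : ℤ) ^ Z₁) * hc₁
  · rw [Int.gcd_add_mul_left_right, Int.gcd_mul_left_right_of_gcd_eq_one, Int.gcd_natCast_natCast]
    rw [← Int.isCoprime_iff_gcd_eq_one]
    exact ((isCoprime_mul_unit_left_right hlu _ _).mpr hBC'.pow_right).pow_right

theorem dvd_of_pow_sub_eq_mul {a M δ ε f g : ℤ} {n D : ℕ} (hM : 2 < M) (hn : 0 < n)
    (hδ : δ = 1 ∨ δ = -1) (hε : ε = 1 ∨ ε = -1)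
    (hleast : ∀ k : ℕ, 0 < k → (∃ d : ℤ, (d = 1 ∨ d = -1) ∧ a ^ k ≡ d [ZMOD M]) → n ≤ k)
    (hf : a ^ n = M * f + δ) (hg : a ^ D - ε = M * g) : f ∣ g := by
  have hdm := Nat.div_add_mod D n
  set q := D / n
  set r := D % n
  have hδq : δ ^ q = 1 ∨ δ ^ q = -1 := by
    rcases hδ with rfl | rfl
    · simp
    · exact neg_one_pow_eq_or ℤ q
  obtain ⟨j, hj⟩ : M * f ∣ a ^ (n * q) - δ ^ q := by
    rw [pow_mul]
    exact (Dvd.intro 1 (by rw [hf]; ring)).trans (sub_dvd_pow_sub_pow (a ^ n) δ q)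
  have hδsq : δ ^ q * δ ^ q = 1 := by rcases hδq with h | h <;> rw [h] <;> norm_num
  rw [← hdm, pow_add] at hg
  have hmod : a ^ r ≡ ε * δ ^ q [ZMOD M] := by
    apply Int.ModEq.symm
    rw [Int.modEq_iff_dvd]
    refine ⟨δ ^ q * (g - f * j * a ^ r), ?_⟩
    linear_combination δ ^ q * hg - δ ^ q * a ^ r * hj - a ^ r * hδsq
  have hr : r = 0 := by
    by_contra hr
    have := hleast r (Nat.pos_of_ne_zero hr) ⟨ε * δ ^ q, by
      rcases hε with rfl | rfl <;> rcases hδq with h | h <;> simp [h], hmod⟩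
    exact absurd (Nat.mod_lt D hn) this.not_gt
  rw [hr, pow_zero] at hmod hg
  have hεδ : ε = δ ^ q := by
    rw [Int.modEq_iff_dvd] at hmod
    have hM2 {x : ℤ} (hx : M ∣ x) (h0 : 0 < |x|) (h2 : |x| ≤ 2) : False := by
      have := Int.le_of_dvd h0 ((dvd_abs _ _).mpr hx)
      omega
    rcases hε with rfl | rfl <;> rcases hδq with h | h <;> rw [h] at hmod ⊢ <;> norm_num at hmod
    · exact (hM2 hmod (by norm_num) (by norm_num)).elim
    · exact (hM2 hmod (by norm_num) (by norm_num)).elim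
  refine ⟨j, ?_⟩
  apply mul_left_cancel₀ (by omega : M ≠ 0)
  rw [← hg, ← mul_assoc, ← hj, hεδ]
  ring

theorem exists_g (A B C : ℕ) (l : ℤ)
    (hA : 1 < A) (hB : 1 < B) (hC : 1 < C)
    (hAB : Nat.Coprime A B) (hAC : Nat.Coprime A C) (hBC : Nat.Coprime B C)
    (hCmax : C = max A (max B C))
    (hl : l = 1 ∨ l = -1)
    (X₁ Y₁ Z₁ X₂ Y₂ Z₂ : ℕ)
    (hsol₁ : IsSol A B C l X₁ Y₁ Z₁) (hsol₂ : IsSol A B C l X₂ Y₂ Z₂)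
    (hZ₁min : ∀ X Y Z, IsSol A B C l X Y Z → Z₁ ≤ Z)
    (hZ₁Z₂ : Z₁ < Z₂)
    (n₁ : ℕ) (δ₁ : ℤ)
    (hn₁pos : 0 < n₁)
    (hδ₁ : δ₁ = 1 ∨ δ₁ = -1)
    (hn₁ : (A : ℤ) ^ n₁ ≡ δ₁ [ZMOD (C : ℤ) ^ Z₁])
    (hn₁least : ∀ n : ℕ, 0 < n →
      (∃ δ : ℤ, (δ = 1 ∨ δ = -1) ∧ (A : ℤ) ^ n ≡ δ [ZMOD (C : ℤ) ^ Z₁]) → n₁ ≤ n)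
    (f : ℕ) (hfpos : 0 < f)
    (hf : (A : ℤ) ^ n₁ = (C : ℤ) ^ Z₁ * (f : ℤ) + δ₁) :
    ∃ g : ℕ, 0 < g ∧
      (A : ℤ) ^ ((X₁ : ℤ) * Y₂ - (X₂ : ℤ) * Y₁).natAbs - (-l) ^ (Y₁ + Y₂) =
        (C : ℤ) ^ Z₁ * (g : ℤ) ∧
      Nat.gcd C g = Nat.gcd C Y₂ ∧ f ∣ g := by
  have hC3 : 3 ≤ C := by
    have hne : A ≠ B := by
      rintro rfl
      simp at hAB
      omega
    omega
  have hA' : (1 : ℤ) < A := by exact_mod_cast hA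
  have hAC' : IsCoprime (C : ℤ) A := Nat.isCoprime_iff_coprime.mpr hAC.symm
  have hC3' : (3 : ℤ) ≤ C := by exact_mod_cast hC3
  have hM : 2 < (C : ℤ) ^ Z₁ := by
    have := le_self_pow₀ (by linarith : (1 : ℤ) ≤ C) hsol₁.2.2.1.ne'
    linarith
  have hε : (-l) ^ (Y₁ + Y₂) = 1 ∨ (-l) ^ (Y₁ + Y₂) = -1 := by
    rcases hl with rfl | rfl
    · exact neg_one_pow_eq_or ℤ _
    · simp
  obtain ⟨h, hh, hgcd⟩ := hsol₁.exists_pow_sub_eq hBC hl hsol₂ hZ₁Z₂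
  have hne := hsol₁.mul_ne_mul hC3 hA hB hAC hBC hl hsol₂ hZ₁Z₂
  set ε := (-l) ^ (Y₁ + Y₂)
  have hD : ((X₁ : ℤ) * Y₂ - (X₂ : ℤ) * Y₁).natAbs ≠ 0 := by
    rw [Int.natAbs_ne_zero, sub_ne_zero]
    exact_mod_cast hne
  obtain ⟨e, he, hfactor⟩ : ∃ e : ℤ, IsCoprime (C : ℤ) e ∧
      ((A : ℤ) ^ ((X₁ : ℤ) * Y₂ - (X₂ : ℤ) * Y₁).natAbs - ε) * e = (C : ℤ) ^ Z₁ * h := by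
    rw [← hh]
    rcases Nat.lt_or_ge (X₁ * Y₂) (X₂ * Y₁) with hlt | hge
    · obtain ⟨d, hd⟩ := Nat.exists_eq_add_of_lt hlt
      refine ⟨-ε * (A : ℤ) ^ (X₁ * Y₂), ?_, ?_⟩
      · rcases hε with hε | hε <;> rw [hε]
        · rw [neg_one_mul]
          exact hAC'.pow_right.neg_right
        · rw [neg_neg, one_mul]
          exact hAC'.pow_right
      · have hd' : ((X₁ : ℤ) * Y₂ - (X₂ : ℤ) * Y₁).natAbs = d + 1 := by zify at hd; omega
        have hεsq : ε * ε = 1 := by rcases hε with hε | hε <;> rw [hε] <;> norm_num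
        rw [hd', hd, add_assoc, pow_add]
        linear_combination (A : ℤ) ^ (X₁ * Y₂) * hεsq
    · obtain ⟨d, hd⟩ := Nat.exists_eq_add_of_le hge
      refine ⟨(A : ℤ) ^ (X₂ * Y₁), hAC'.pow_right, ?_⟩
      have hd' : ((X₁ : ℤ) * Y₂ - (X₂ : ℤ) * Y₁).natAbs = d := by zify at hd; omega
      rw [hd', hd, pow_add]
      ring
  obtain ⟨g, hg⟩ : (C : ℤ) ^ Z₁ ∣ (A : ℤ) ^ ((X₁ : ℤ) * Y₂ - (X₂ : ℤ) * Y₁).natAbs - ε :=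
    he.pow_left.dvd_of_dvd_mul_right (Dvd.intro _ hfactor.symm)
  have hgpos : 0 < g := by
    have h1 := one_lt_pow₀ hA' hD
    have h2 : 0 < (C : ℤ) ^ Z₁ * g := by
      rw [← hg]
      rcases hε with hε | hε <;> rw [hε] <;> linarith
    exact pos_of_mul_pos_right h2 (by linarith)
  have hfg := dvd_of_pow_sub_eq_mul hM hn₁pos hδ₁ hε hn₁least hf hg
  have hgh : g * e = h := by
    apply mul_left_cancel₀ (by linarith : (C : ℤ) ^ Z₁ ≠ 0)
    rw [← hfactor, hg, mul_assoc]
  lift g to ℕ using hgpos.le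
  refine ⟨g, by exact_mod_cast hgpos, hg, ?_, by exact_mod_cast hfg⟩
  rw [← hgcd, ← hgh, Int.gcd_mul_left_right_of_gcd_eq_one (Int.isCoprime_iff_gcd_eq_one.mp he),
    Int.gcd_natCast_natCast]
end
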